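/- Let R^3 be the profile ≽_1: a,c,{b,d}; ≽_2: {b,d},a,c; ≽_3: a,d,{b,c}; ≽_4: {b,c},a,d. Then f(R^3)(c) = f(R^3)(d) = 0. -/

import Mathlib

open Finset
open scoped Classical

section Framework

variable {A : Type*} [Fintype A] {n : ℕ}

/-- `p` is a lottery (probability distribution) on the set of alternatives `A`. -/
def IsLottery (p : A → ℝ) : Prop := (∀ x, 0 ≤ p x) ∧ ∑ x, p x = 1

/-- `r` is a weak preference relation: complete (total) and transitive. -/
def IsPref (r : A → A → Prop) : Prop := Total r ∧ Transitive r

/-- A preference profile assigns a weak preference relation to each of the `n` agents. -/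
def IsProfile (R : Fin n → A → A → Prop) : Prop := ∀ i, IsPref (R i)

/-- The probability that `p` assigns to alternatives weakly preferred (by `r`) to `x`. -/
noncomputable def upperProb (r : A → A → Prop) (p : A → ℝ) (x : A) : ℝ :=
  ∑ y ∈ univ.filter (fun y => r y x), p y

/-- Stochastic dominance: `p ≽^sd q` w.r.t. the preference relation `r`. -/
def SDge (r : A → A → Prop) (p q : A → ℝ) : Prop :=
  ∀ x, upperProb r q x ≤ upperProb r p x

/-- Strict stochastic dominance: `p ≻^sd q` w.r.t. the preference relation `r`. -/
def SDgt (r : A → A → Prop) (p q : A → ℝ) : Prop :=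
  SDge r p q ∧ ¬ SDge r q p

/-- A social decision scheme maps every preference profile to a lottery. -/
def IsSDS (f : (Fin n → A → A → Prop) → (A → ℝ)) : Prop :=
  ∀ R : Fin n → A → A → Prop, IsProfile R → IsLottery (f R)

/-- Anonymity: invariance under permutations of the agents. -/
def Anonymous (f : (Fin n → A → A → Prop) → (A → ℝ)) : Prop :=
  ∀ R : Fin n → A → A → Prop, IsProfile R → ∀ π : Equiv.Perm (Fin n),
    f (fun i => R (π i)) = f R

/-- Neutrality: `f(R^σ)(σ x) = f(R)(x)`, where `R^σ` relabels alternatives by `σ`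
(i.e. `σ x ≽^σ_i σ y ↔ x ≽_i y`). -/
def Neutral (f : (Fin n → A → A → Prop) → (A → ℝ)) : Prop :=
  ∀ R : Fin n → A → A → Prop, IsProfile R → ∀ σ : Equiv.Perm A, ∀ x : A,
    f (fun i u v => R i (σ.symm u) (σ.symm v)) (σ x) = f R x

/-- The lottery `p` is sd-efficient for the profile `R`: no lottery `q` is weakly
sd-preferred to `p` by all agents and strictly sd-preferred by some agent. -/
def SDEfficientLottery (R : Fin n → A → A → Prop) (p : A → ℝ) : Prop :=
  ¬ ∃ q : A → ℝ, IsLottery q ∧ (∀ i, SDge (R i) q p) ∧ (∃ i, SDgt (R i) q p)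

/-- sd-efficiency of a social decision scheme. -/
def SDEfficient (f : (Fin n → A → A → Prop) → (A → ℝ)) : Prop :=
  ∀ R : Fin n → A → A → Prop, IsProfile R → SDEfficientLottery R (f R)

/-- sd-strategyproofness: no agent can misreport and obtain a strictly
sd-preferred lottery. -/
def SDStrategyproof (f : (Fin n → A → A → Prop) → (A → ℝ)) : Prop :=
  ∀ R R' : Fin n → A → A → Prop, IsProfile R → IsProfile R' → ∀ i : Fin n,
    (∀ j, j ≠ i → R j = R' j) → ¬ SDgt (R i) (f R') (f R)

/-- `x` is the unique most-preferred alternative of the relation `r`. -/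
def UniqueTop (r : A → A → Prop) (x : A) : Prop :=
  ∀ y, y ≠ x → r x y ∧ ¬ r y x

/-- `f` extends random dictatorship: whenever every agent has a unique top choice,
each alternative gets probability (number of agents having it as top)/n. -/
def ExtendsRD (f : (Fin n → A → A → Prop) → (A → ℝ)) : Prop :=
  ∀ R : Fin n → A → A → Prop, IsProfile R →
    ∀ t : Fin n → A, (∀ i, UniqueTop (R i) (t i)) →
      ∀ x : A, f R x = ((univ.filter (fun i => t i = x)).card : ℝ) / (n : ℝ)

/-- `x` is Pareto-dominated in the profile `R`. -/
def Pareto_Dominated (R : Fin n → A → A → Prop) (x : A) : Prop :=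
  ∃ y : A, (∀ i, R i y x) ∧ ∃ i, R i y x ∧ ¬ R i x y

end Framework

/-! Concrete setting: alternatives `A = {a,b,c,d}` encoded as `Fin 4`. -/

/-- The alternative `a`. -/ def a : Fin 4 := 0
/-- The alternative `b`. -/ def b : Fin 4 := 1
/-- The alternative `c`. -/ def c : Fin 4 := 2
/-- The alternative `d`. -/ def d : Fin 4 := 3

/-- The weak preference relation induced by a rank function over `(a,b,c,d)`
(lower rank = more preferred; equal ranks = indifference). -/
def pr (rk : Fin 4 → ℕ) : Fin 4 → Fin 4 → Prop := fun x y => rk x ≤ rk y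


/-- The profile `R3`: ≽₁: a,c,{b,d}; ≽₂: {b,d},a,c; ≽₃: a,d,{b,c}; ≽₄: {b,c},a,d. -/
def R3 : Fin 4 → Fin 4 → Fin 4 → Prop :=
  ![pr ![0,2,1,2], pr ![1,0,2,0], pr ![0,2,2,1], pr ![1,0,0,2]]

lemma isPref_pr (rk : Fin 4 → ℕ) : IsPref (pr rk) :=
  ⟨fun x y => le_total (rk x) (rk y), fun _ _ _ hxy hyz => le_trans hxy hyz⟩

lemma isProfile_R3 : IsProfile R3 := by
  intro i
  fin_cases i <;> exact isPref_pr _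

/-- Swapping agents 1 and 3 as well as 2 and 4 undoes the swap of `c` and `d` in `R3`. -/
lemma R3_swap :
    (fun i u v => R3 ((Equiv.swap 0 2 * Equiv.swap 1 3 : Equiv.Perm (Fin 4)) i)
      ((Equiv.swap c d).symm u) ((Equiv.swap c d).symm v)) = R3 := by
  funext i u v
  fin_cases i <;> fin_cases u <;> fin_cases v <;>
    simp [R3, pr, c, d, Equiv.swap_apply_def]

/-- An anonymous and neutral SDS treats `c` and `d` alike in `R3`. -/
lemma apply_R3_c_eq_d (f : (Fin 4 → Fin 4 → Fin 4 → Prop) → (Fin 4 → ℝ))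
    (han : Anonymous f) (hneu : Neutral f) : f R3 c = f R3 d := by
  have hprof : IsProfile fun i u v =>
      R3 i ((Equiv.swap c d).symm u) ((Equiv.swap c d).symm v) := fun i =>
    ⟨fun _ _ => (isProfile_R3 i).1 _ _, fun _ _ _ hxy hyz => (isProfile_R3 i).2 hxy hyz⟩
  have hanon := han _ hprof (Equiv.swap 0 2 * Equiv.swap 1 3)
  rw [R3_swap] at hanon
  have hswap := hneu R3 isProfile_R3 (Equiv.swap c d) c
  rw [← hanon, Equiv.swap_apply_left] at hswap
  exact hswap.symm

/-- Moving probability `e` from each of `c` and `d` to each of `a` and `b`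
is an sd-improvement for every agent in `R3`. -/
lemma SDge_R3_shift (p : Fin 4 → ℝ) {e : ℝ} (he : 0 ≤ e) (i : Fin 4) :
    SDge (R3 i) (p + ![e, e, -e, -e]) p := by
  intro x
  fin_cases i <;> fin_cases x <;>
    simp [upperProb, Finset.sum_filter, Fin.sum_univ_four, R3, pr] <;> linarith

/-- The first agent's sd-improvement by such a move is strict. -/
lemma not_SDge_R3_shift (p : Fin 4 → ℝ) {e : ℝ} (he : 0 < e) :
    ¬ SDge (R3 0) p (p + ![e, e, -e, -e]) := by
  intro h
  have ha := h a
  simp [upperProb, Finset.sum_filter, Fin.sum_univ_four, R3, pr, a] at ha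
  linarith

/-- An sd-efficient lottery for `R3` does not have both `c` and `d` in its support. -/
lemma not_pos_c_d_of_efficient_R3 {p : Fin 4 → ℝ} (hp : IsLottery p)
    (heff : SDEfficientLottery R3 p) : ¬ (0 < p c ∧ 0 < p d) := by
  intro ⟨hc, hd⟩
  obtain ⟨hnonneg, hsum⟩ := hp
  have he : 0 < min (p c) (p d) := lt_min hc hd
  refine heff ⟨p + ![min (p c) (p d), min (p c) (p d), -min (p c) (p d), -min (p c) (p d)],
    ⟨fun x => ?_, ?_⟩, SDge_R3_shift p he.le, 0, SDge_R3_shift p he.le 0,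
    not_SDge_R3_shift p he⟩
  · fin_cases x
    · exact add_nonneg (hnonneg a) he.le
    · exact add_nonneg (hnonneg b) he.le
    · exact sub_nonneg.2 (min_le_left (p c) (p d))
    · exact sub_nonneg.2 (min_le_right (p c) (p d))
  · rw [Fin.sum_univ_four] at hsum ⊢
    simp
    linarith

theorem stmt5 (f : (Fin 4 → Fin 4 → Fin 4 → Prop) → (Fin 4 → ℝ))
    (hf : IsSDS f) (han : Anonymous f) (hneu : Neutral f)
    (heff : SDEfficient f) (hsp : SDStrategyproof f) :
    f R3 c = 0 ∧ f R3 d = 0 := by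
  have hcd := apply_R3_c_eq_d f han hneu
  have hlot := hf R3 isProfile_R3
  have hpos := not_pos_c_d_of_efficient_R3 hlot (heff R3 isProfile_R3)
  rw [← hcd, and_self, not_lt] at hpos
  have hc : f R3 c = 0 := le_antisymm hpos (hlot.1 c)
  exact ⟨hc, hcd ▸ hc⟩
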